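/- arXiv:math/0102168 — 2 statements merged into one kernel-verified Lean document; each statement's English description precedes it below -/
import Mathlib

section
/- For all y, w ∈ S_n with y ≤ w in Bruhat order, #R(y,w) ≥ l(w) − l(y). (Deodhar's inequality in type A.) -/
open scoped Classical

namespace BSW

/-- The number of inversions (the length) of a permutation of `Fin n`. -/
def invLen {n : ℕ} (w : Equiv.Perm (Fin n)) : ℕ :=
  (Finset.univ.filter (fun p : Fin n × Fin n => p.1 < p.2 ∧ w p.2 < w p.1)).card

/-- The rank function `r_w(p,q) = #{i : 1 ≤ i ≤ p and w(i) ≥ q}`, where the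
permutation of `Fin n` is regarded as a permutation of `{1,…,n}` (so position
`i : Fin n` corresponds to `i+1` and value `w i` to `(w i)+1`). -/
def rank {n : ℕ} (w : Equiv.Perm (Fin n)) (p q : ℤ) : ℕ :=
  (Finset.univ.filter (fun i : Fin n =>
    ((i : ℕ) : ℤ) + 1 ≤ p ∧ q ≤ ((w i : ℕ) : ℤ) + 1)).card

/-- The difference function `d_{x,w}(p,q) = r_w(p,q) − r_x(p,q)`. -/
def dxw {n : ℕ} (x w : Equiv.Perm (Fin n)) (p q : ℤ) : ℤ :=
  (rank w p q : ℤ) - (rank x p q : ℤ)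

/-- The Bruhat order: `x ≤ w` iff `d_{x,w}` is everywhere non-negative. -/
def bruhatLE {n : ℕ} (x w : Equiv.Perm (Fin n)) : Prop :=
  ∀ p q : ℤ, 0 ≤ dxw x w p q

/-- The set of transpositions in `S_n`. -/
def transpositions (n : ℕ) : Set (Equiv.Perm (Fin n)) :=
  {t | ∃ a b : Fin n, a ≠ b ∧ t = Equiv.swap a b}

/-- `R(x,w) = {t ∈ T : l(xt) > l(x) and xt ≤ w}`. -/
def R {n : ℕ} (x w : Equiv.Perm (Fin n)) : Set (Equiv.Perm (Fin n)) :=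
  {t | t ∈ transpositions n ∧ invLen x < invLen (x * t) ∧ bruhatLE (x * t) w}

/-- `x` is a maximal singular point (MSP) for `w`. -/
def MSP {n : ℕ} (x w : Equiv.Perm (Fin n)) : Prop :=
  bruhatLE x w ∧ ((invLen w : ℤ) - (invLen x : ℤ) < ((R x w).ncard : ℤ)) ∧
    ∀ t ∈ R x w, ((R (x * t) w).ncard : ℤ) = (invLen w : ℤ) - (invLen (x * t) : ℤ)

/-- `Δ(x,w) = {i : t_{{i,j}} ∈ R(x,w) for some j}`. -/
def Delta {n : ℕ} (x w : Equiv.Perm (Fin n)) : Set (Fin n) :=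
  {i | ∃ j : Fin n, Equiv.swap i j ∈ R x w}

/-- `Δ(x,w)` as a finset. -/
noncomputable def DeltaFinset {n : ℕ} (x w : Equiv.Perm (Fin n)) : Finset (Fin n) :=
  (Set.toFinite (Delta x w)).toFinset

/-- `σ ∈ S_k` is the flattening of `x` along the increasing enumeration `d_1 < … < d_k`
of a set `D` of positions with `#D = k`: the unique permutation of `{1,…,k}` with
`σ(a) < σ(b)` iff `x(d_a) < x(d_b)`. -/
def IsFlatteningOn {n k : ℕ} (x : Equiv.Perm (Fin n)) (D : Finset (Fin n))
    (hD : D.card = k) (σ : Equiv.Perm (Fin k)) : Prop :=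
  ∀ a b : Fin k, σ a < σ b ↔ x ((D.orderIsoOfFin hD a : Fin n)) < x ((D.orderIsoOfFin hD b : Fin n))

/-- Values (0-indexed) of the permutation `x_{k,m} = [k,…,1, k+m,…,k+1]`. -/
def xkmVal (k m i : ℕ) : ℕ :=
  if i < k then k - 1 - i else 2 * k + m - 1 - i

/-- Values (0-indexed) of the permutation `w_{k,m} = [k+m, k,…,2, k+m−1,…,k+1, 1]`. -/
def wkmVal (k m i : ℕ) : ℕ :=
  if i = 0 then k + m - 1
  else if i < k then k - i
  else if i < k + m - 1 then 2 * k + m - 2 - i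
  else 0

/-- Values (0-indexed) of the permutation `x_{k,l,m} = [k,…,1, k+l,…,k+1, k+l+m,…,k+l+1]`. -/
def xklmVal (k l m i : ℕ) : ℕ :=
  if i < k then k - 1 - i
  else if i < k + l then 2 * k + l - 1 - i
  else 2 * (k + l) + m - 1 - i

/-- Values (0-indexed) of the permutation
`w_{k,l,m} = [k+l, k,…,2, k+l+m, k+l−1,…,k+2, 1, k+l+m−1,…,k+l+1, k+1]`. -/
def wklmVal (k l m i : ℕ) : ℕ :=
  if i = 0 then k + l - 1
  else if i < k then k - i
  else if i = k then k + l + m - 1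
  else if i < k + l - 1 then 2 * k + l - 1 - i
  else if i = k + l - 1 then 0
  else if i < k + l + m - 1 then 2 * (k + l) + m - 2 - i
  else k

/-- The indicator of the event that value `v` at position `k` is counted in `r(p,q)`. -/
def cell {n : ℕ} (p q : ℕ) (k v : Fin n) : ℤ :=
  if (k : ℕ) < p ∧ q ≤ (v : ℕ) then 1 else 0

/-- The rank function with `0`-indexed natural number arguments. -/
def natRank {n : ℕ} (w : Equiv.Perm (Fin n)) (p q : ℕ) : ℤ :=
  ∑ k, cell p q k (w k)

lemma rank_eq_natRank {n : ℕ} (w : Equiv.Perm (Fin n)) (p q : ℤ) :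
    (rank w p q : ℤ) = natRank w p.toNat (q - 1).toNat := by
  unfold rank natRank cell
  rw [Finset.card_filter]
  push_cast
  refine Finset.sum_congr rfl fun k _ => ?_
  congr 1
  apply propext
  omega

lemma bruhatLE_iff {n : ℕ} {x w : Equiv.Perm (Fin n)} :
    bruhatLE x w ↔ ∀ p q : ℕ, natRank x p q ≤ natRank w p q := by
  unfold bruhatLE dxw
  simp only [rank_eq_natRank, sub_nonneg]
  constructor
  · intro h p q
    simpa using h p (q + 1)
  · intro h p q
    exact h _ _

lemma bruhatLE_refl {n : ℕ} (w : Equiv.Perm (Fin n)) : bruhatLE w w :=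
  bruhatLE_iff.2 fun _ _ => le_rfl

lemma bruhatLE.trans {n : ℕ} {x y w : Equiv.Perm (Fin n)} (h : bruhatLE x y)
    (h' : bruhatLE y w) : bruhatLE x w :=
  bruhatLE_iff.2 fun p q => (bruhatLE_iff.1 h p q).trans (bruhatLE_iff.1 h' p q)

lemma natRank_mul_swap {n : ℕ} (x : Equiv.Perm (Fin n)) {i j : Fin n} (hij : i < j)
    (hv : x i < x j) (p q : ℕ) :
    natRank (x * Equiv.swap i j) p q = natRank x p q +
      if (i : ℕ) < p ∧ p ≤ j ∧ (x i : ℕ) < q ∧ q ≤ x j then 1 else 0 := by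
  rw [← sub_eq_iff_eq_add']
  unfold natRank
  rw [← Finset.sum_sub_distrib, Fintype.sum_eq_add i j hij.ne]
  · simp only [cell, Equiv.Perm.coe_mul, Function.comp_apply, Equiv.swap_apply_left,
      Equiv.swap_apply_right]
    rw [Fin.lt_def] at hij hv
    split_ifs <;> omega
  · rintro k ⟨hi, hj⟩
    simp [Equiv.swap_apply_of_ne_of_ne hi hj]

lemma bruhatLE_mul_swap {n : ℕ} (x : Equiv.Perm (Fin n)) {i j : Fin n} (hij : i < j)
    (hv : x i < x j) : bruhatLE x (x * Equiv.swap i j) := by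
  refine bruhatLE_iff.2 fun p q => ?_
  rw [natRank_mul_swap x hij hv]
  split_ifs <;> simp

lemma mul_swap_bruhatLE {n : ℕ} (x : Equiv.Perm (Fin n)) {i j : Fin n} (hij : i < j)
    (hv : x j < x i) : bruhatLE (x * Equiv.swap i j) x := by
  have h := bruhatLE_mul_swap (x * Equiv.swap i j) hij (by simpa using hv)
  simpa [mul_assoc] using h

lemma invLen_lt_mul_swap {n : ℕ} (x : Equiv.Perm (Fin n)) {i j : Fin n} (hij : i < j)
    (hv : x i < x j) : invLen x < invLen (x * Equiv.swap i j) := by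
  set t := Equiv.swap i j with ht
  have htt : ∀ k, t (t k) = k := Equiv.swap_apply_self i j
  have hti : t i = j := Equiv.swap_apply_left i j
  have htj : t j = i := Equiv.swap_apply_right i j
  have hto : ∀ k, k ≠ i → k ≠ j → t k = k := fun k => Equiv.swap_apply_of_ne_of_ne
  have hxinj : ∀ k l, x k = x l → k = l := fun k l h => x.injective h
  unfold invLen
  let φ : Fin n × Fin n → Fin n × Fin n :=
    fun r => if t r.1 < t r.2 then (t r.1, t r.2) else r
  have hφ : Set.InjOn φ (Finset.univ.filter
      (fun r : Fin n × Fin n => r.1 < r.2 ∧ x r.2 < x r.1) : Finset (Fin n × Fin n)) := by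
    rintro ⟨p, q⟩ hr ⟨p', q'⟩ hr' h
    simp only [Finset.coe_filter, Finset.mem_univ, true_and, Set.mem_ofPred_eq] at hr hr'
    simp only [φ] at h
    clear_value t
    split_ifs at h <;> grind
  rw [← Finset.card_image_of_injOn hφ]
  refine Finset.card_lt_card (Finset.ssubset_iff_subset_ne.2 ⟨?_, fun h => ?_⟩)
  · intro r hr
    simp only [Finset.mem_image, Finset.mem_filter, Finset.mem_univ, true_and] at hr ⊢
    obtain ⟨⟨p, q⟩, ⟨hpq, hx⟩, rfl⟩ := hr
    simp only [φ, Equiv.Perm.coe_mul, Function.comp_apply]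
    split_ifs with hlt
    · simpa [htt] using ⟨hlt, hx⟩
    · refine ⟨hpq, ?_⟩
      by_cases hpi : p = i <;> by_cases hpj : p = j <;> by_cases hqi : q = i <;>
        by_cases hqj : q = j <;> grind
  · have hmem : (i, j) ∈ Finset.univ.filter
        (fun r : Fin n × Fin n => r.1 < r.2 ∧ (x * t) r.2 < (x * t) r.1) := by
      rw [Finset.mem_filter]
      simp [hti, htj, hij, hv]
    rw [← h] at hmem
    simp only [Finset.mem_image, Finset.mem_filter, Finset.mem_univ, true_and] at hmem
    obtain ⟨⟨p, q⟩, ⟨hpq, hx⟩, hp⟩ := hmem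
    simp only [φ] at hp
    split_ifs at hp <;> grind

lemma invLen_le {n : ℕ} (x : Equiv.Perm (Fin n)) : invLen x ≤ n * n := by
  unfold invLen
  exact (Finset.card_le_univ _).trans (by simp)

/-- Below `w`, every `x ≠ w` has an upward transposition step staying below `w`. -/
lemma exists_swap_le {n : ℕ} {x w : Equiv.Perm (Fin n)} (h : bruhatLE x w) (hne : x ≠ w) :
    ∃ i j, i < j ∧ x i < x j ∧ bruhatLE (x * Equiv.swap i j) w := by
  have hr := bruhatLE_iff.1 h
  have hex : ∃ i, x i ≠ w i := by
    by_contra! hc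
    exact hne (Equiv.ext hc)
  obtain ⟨i, hi, hmin⟩ := WellFounded.has_min (wellFounded_lt (α := Fin n)) {i | x i ≠ w i} hex
  replace hmin : ∀ k < i, x k = w k := fun k hk => by
    by_contra hc
    exact hmin k hc hk
  have hxw : x i < w i := by
    by_contra hc
    have hlt : w i < x i := lt_of_le_of_ne (not_lt.1 hc) (Ne.symm hi)
    have := hr (i + 1) (x i)
    refine absurd this (not_le.2 ?_)
    refine Finset.sum_lt_sum (fun k _ => ?_) ⟨i, Finset.mem_univ _, ?_⟩
    · rcases lt_trichotomy k i with hk | rfl | hk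
      · rw [hmin k hk]
      · unfold cell
        split_ifs <;> grind
      · unfold cell
        split_ifs <;> grind
    · unfold cell
      split_ifs <;> grind
  have hex' : ∃ j, i < j ∧ x i < x j ∧ x j ≤ w i := by
    refine ⟨x.symm (w i), ?_, by simpa using hxw, by simp⟩
    by_contra hc
    rcases lt_or_eq_of_le (not_lt.1 hc) with hlt | heq
    · have := hmin _ hlt
      rw [Equiv.apply_symm_apply] at this
      exact hlt.ne (w.injective this).symm
    · rw [← heq, Equiv.apply_symm_apply] at hxw
      rw [heq] at hxw
      exact lt_irrefl _ hxw
  obtain ⟨j, ⟨hij, hv, hjw⟩, hjmin⟩ := WellFounded.has_min (wellFounded_lt (α := Fin n))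
    {j | i < j ∧ x i < x j ∧ x j ≤ w i} hex'
  replace hjmin : ∀ k, i < k → k < j → x i < x k → w i < x k := fun k hik hkj hk => by
    by_contra hc
    exact hjmin k ⟨hik, hk, not_lt.1 hc⟩ hkj
  refine ⟨i, j, hij, hv, bruhatLE_iff.2 fun p q => ?_⟩
  rw [natRank_mul_swap x hij hv]
  split_ifs with hpq
  · obtain ⟨hip, hpj, hxq, hqx⟩ := hpq
    have h1 := hr p (w i + 1)
    have h2 : natRank x p q - natRank x p (w i + 1) + 1 ≤
        natRank w p q - natRank w p (w i + 1) := by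
      unfold natRank
      rw [← Finset.sum_sub_distrib, ← Finset.sum_sub_distrib, Int.add_one_le_iff]
      refine Finset.sum_lt_sum (fun k _ => ?_) ⟨i, Finset.mem_univ _, ?_⟩
      · rcases lt_trichotomy k i with hk | rfl | hk
        · rw [hmin k hk]
        · unfold cell
          split_ifs <;> grind
        · have := hjmin k hk
          unfold cell
          split_ifs <;> grind
      · unfold cell
        split_ifs <;> grind
    linarith
  · simpa using hr p q

/-- The indicator of `x t_{i,j} ≤ w`. -/
noncomputable def swapInd {n : ℕ} (x w : Equiv.Perm (Fin n)) (i j : Fin n) : ℤ :=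
  if bruhatLE (x * Equiv.swap i j) w then 1 else 0

lemma swapInd_comm {n : ℕ} (x w : Equiv.Perm (Fin n)) (i j : Fin n) :
    swapInd x w i j = swapInd x w j i := by
  unfold swapInd
  rw [Equiv.swap_comm]

lemma swapInd_self {n : ℕ} {x w : Equiv.Perm (Fin n)} (h : bruhatLE x w) (i : Fin n) :
    swapInd x w i i = 1 := by
  rw [swapInd, Equiv.swap_self, if_pos]
  exact h

lemma swapInd_mul_swap_of_disjoint {n : ℕ} {x w : Equiv.Perm (Fin n)} {a b i j : Fin n}
    (hab : a < b) (hv : x a < x b) (hia : i ≠ a) (hib : i ≠ b) (hja : j ≠ a) (hjb : j ≠ b) :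
    swapInd (x * Equiv.swap a b) w i j ≤ swapInd x w i j := by
  have key : bruhatLE (x * Equiv.swap a b * Equiv.swap i j) w →
      bruhatLE (x * Equiv.swap i j) w := by
    intro h
    have hc : Equiv.swap a b * Equiv.swap i j = Equiv.swap i j * Equiv.swap a b := by
      rw [Equiv.mul_swap_eq_swap_mul, Equiv.swap_apply_of_ne_of_ne hia hib,
        Equiv.swap_apply_of_ne_of_ne hja hjb]
    rw [mul_assoc, hc, ← mul_assoc] at h
    refine (bruhatLE_mul_swap _ hab ?_).trans h
    simpa [Equiv.swap_apply_of_ne_of_ne hia.symm hja.symm,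
      Equiv.swap_apply_of_ne_of_ne hib.symm hjb.symm] using hv
  unfold swapInd
  split_ifs <;> simp_all

lemma natRank_eq_cells {n : ℕ} {x u : Equiv.Perm (Fin n)} {a b c : Fin n} (hab : a ≠ b)
    (hac : a ≠ c) (hbc : b ≠ c) (hu : ∀ k, k ≠ a → k ≠ b → k ≠ c → u k = x k) (p q : ℕ) :
    natRank u p q = cell p q a (u a) + cell p q b (u b) + cell p q c (u c) +
      ∑ k ∈ (({a, b, c} : Finset (Fin n)))ᶜ, cell p q k (x k) := by
  unfold natRank
  rw [← Finset.sum_add_sum_compl {a, b, c}, Finset.sum_insert (by simp [hab, hac]),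
    Finset.sum_insert (by simp [hbc]), Finset.sum_singleton]
  congr 1
  · ring
  · refine Finset.sum_congr rfl fun k hk => ?_
    simp only [Finset.mem_compl, Finset.mem_insert, Finset.mem_singleton, not_or] at hk
    rw [hu k hk.1 hk.2.1 hk.2.2]

/-- The bound `W` dominates `S` plus the cells of the values `u, v, z` at positions `a, b, c`. -/
def CellsLE {n : ℕ} (S W : ℕ → ℕ → ℤ) (a b c u v z : Fin n) : Prop :=
  ∀ p q, cell p q a u + cell p q b v + cell p q c z + S p q ≤ W p q

lemma cellsLE_or_left {n : ℕ} {a b c u v z : Fin n} {S W : ℕ → ℕ → ℤ}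
    (hab : a < b) (huv : u < v) (hpos : c < a ∨ (a < c ∧ c < b) ∨ b < c)
    (hval : z < u ∨ (u < z ∧ z < v) ∨ v < z) (hX : CellsLE S W a b c u v z)
    (hT : CellsLE S W a b c v u z) (hC : CellsLE S W a b c z u v) :
    CellsLE S W a b c z v u ∨ CellsLE S W a b c u z v := by
  rcases hpos with hpos | hpos | hpos <;> rcases hval with hval | hval | hval <;>
    first
    | (left; intro p q; specialize hX p q; specialize hT p q; specialize hC p q
       unfold cell at *; grind)
    | (right; intro p q; specialize hX p q; specialize hT p q; specialize hC p q
       unfold cell at *; grind)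

lemma cellsLE_or_right {n : ℕ} {a b c u v z : Fin n} {S W : ℕ → ℕ → ℤ}
    (hab : a < b) (huv : u < v) (hpos : c < a ∨ (a < c ∧ c < b) ∨ b < c)
    (hval : z < u ∨ (u < z ∧ z < v) ∨ v < z) (hX : CellsLE S W a b c u v z)
    (hT : CellsLE S W a b c v u z) (hD : CellsLE S W a b c v z u) :
    CellsLE S W a b c z v u ∨ CellsLE S W a b c u z v := by
  rcases hpos with hpos | hpos | hpos <;> rcases hval with hval | hval | hval <;>
    first
    | (left; intro p q; specialize hX p q; specialize hT p q; specialize hD p q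
       unfold cell at *; grind)
    | (right; intro p q; specialize hX p q; specialize hT p q; specialize hD p q
       unfold cell at *; grind)

lemma cellsLE_and {n : ℕ} {a b c u v z : Fin n} {S W : ℕ → ℕ → ℤ}
    (hab : a < b) (huv : u < v) (hpos : c < a ∨ (a < c ∧ c < b) ∨ b < c)
    (hval : z < u ∨ (u < z ∧ z < v) ∨ v < z) (hX : CellsLE S W a b c u v z)
    (hC : CellsLE S W a b c z u v) (hD : CellsLE S W a b c v z u) :
    CellsLE S W a b c z v u ∧ CellsLE S W a b c u z v := by
  rcases hpos with hpos | hpos | hpos <;> rcases hval with hval | hval | hval <;>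
    constructor <;> intro p q <;> specialize hX p q <;> specialize hC p q <;> specialize hD p q <;> unfold cell at * <;> grind

lemma swapInd_add_mul_swap_le {n : ℕ} {x w : Equiv.Perm (Fin n)} {a b c : Fin n}
    (hab : a < b) (hv : x a < x b) (hca : c ≠ a) (hcb : c ≠ b) (hx : bruhatLE x w)
    (hxt : bruhatLE (x * Equiv.swap a b) w) :
    swapInd (x * Equiv.swap a b) w a c + swapInd (x * Equiv.swap a b) w b c ≤
      swapInd x w a c + swapInd x w b c := by
  set S : ℕ → ℕ → ℤ := fun p q => ∑ k ∈ (({a, b, c} : Finset (Fin n)))ᶜ, cell p q k (x k)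
  have hrk : ∀ u : Equiv.Perm (Fin n), (∀ k, k ≠ a → k ≠ b → k ≠ c → u k = x k) →
      (bruhatLE u w ↔ CellsLE S (natRank w) a b c (u a) (u b) (u c)) := by
    intro u hu
    simp only [bruhatLE_iff, natRank_eq_cells hab.ne hca.symm hcb.symm hu]
    rfl
  have hs : ∀ i j k : Fin n, k ≠ i → k ≠ j → Equiv.swap i j k = k :=
    fun i j k => Equiv.swap_apply_of_ne_of_ne
  have hxc : x c ≠ x a := fun h => hca (x.injective h)
  have hxc' : x c ≠ x b := fun h => hcb (x.injective h)
  have hX := (hrk x fun _ _ _ _ => rfl).1 hx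
  have hT := (hrk (x * Equiv.swap a b) (by intro k h1 h2 h3; simp [*])).1 hxt
  have hA := hrk (x * Equiv.swap a c) (by intro k h1 h2 h3; simp [*])
  have hB := hrk (x * Equiv.swap b c) (by intro k h1 h2 h3; simp [*])
  have hC := hrk (x * Equiv.swap a b * Equiv.swap a c)
    (by intro k h1 h2 h3; simp [*])
  have hD := hrk (x * Equiv.swap a b * Equiv.swap b c)
    (by intro k h1 h2 h3; simp [*])
  simp only [Equiv.Perm.coe_mul, Function.comp_apply, Equiv.swap_apply_left,
    Equiv.swap_apply_right, hs a b c hca hcb, hs a c b hab.ne' hcb.symm,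
    hs b c a hab.ne hca.symm] at hT hA hB hC hD
  have hpos : c < a ∨ (a < c ∧ c < b) ∨ b < c := by omega
  have hval : x c < x a ∨ (x a < x c ∧ x c < x b) ∨ x b < x c := by omega
  have h1 : bruhatLE (x * Equiv.swap a b * Equiv.swap a c) w →
      bruhatLE (x * Equiv.swap a c) w ∨ bruhatLE (x * Equiv.swap b c) w := by
    rw [hA, hB, hC]
    exact cellsLE_or_left hab hv hpos hval hX hT
  have h2 : bruhatLE (x * Equiv.swap a b * Equiv.swap b c) w →
      bruhatLE (x * Equiv.swap a c) w ∨ bruhatLE (x * Equiv.swap b c) w := by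
    rw [hA, hB, hD]
    exact cellsLE_or_right hab hv hpos hval hX hT
  have h3 : bruhatLE (x * Equiv.swap a b * Equiv.swap a c) w →
      bruhatLE (x * Equiv.swap a b * Equiv.swap b c) w →
      bruhatLE (x * Equiv.swap a c) w ∧ bruhatLE (x * Equiv.swap b c) w := by
    rw [hA, hB, hC, hD]
    exact cellsLE_and hab hv hpos hval hX
  unfold swapInd
  split_ifs <;> simp_all

/-- The number of transpositions `t` with `x t ≤ w`. -/
noncomputable def pairCount {n : ℕ} (x w : Equiv.Perm (Fin n)) : ℕ :=
  (Finset.univ.filter (fun r : Fin n × Fin n =>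
    r.1 < r.2 ∧ bruhatLE (x * Equiv.swap r.1 r.2) w)).card

/-- The number of transpositions `t` with `x < x t ≤ w`. -/
noncomputable def upCount {n : ℕ} (x w : Equiv.Perm (Fin n)) : ℕ :=
  (Finset.univ.filter (fun r : Fin n × Fin n =>
    (r.1 < r.2 ∧ bruhatLE (x * Equiv.swap r.1 r.2) w) ∧ x r.1 < x r.2)).card

lemma sum_eq_diag_add_two_mul {n : ℕ} (F : Fin n → Fin n → ℤ) (hF : ∀ i j, F i j = F j i) :
    ∑ i, ∑ j, F i j = ∑ i, F i i + 2 * ∑ i, ∑ j, if i < j then F i j else 0 := by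
  have h1 : ∀ i j, F i j = (if i = j then F i j else 0) + (if i < j then F i j else 0) +
      (if j < i then F i j else 0) := by
    intro i j
    rcases lt_trichotomy i j with h | h | h
    · simp [h, h.ne, h.not_gt]
    · simp [h]
    · simp [h, h.ne', h.not_gt]
  have h2 : ∑ i, ∑ j, (if j < i then F i j else 0) =
      ∑ i, ∑ j, if i < j then F i j else 0 := by
    rw [Finset.sum_comm]
    exact Finset.sum_congr rfl fun i _ => Finset.sum_congr rfl fun j _ => by rw [hF j i]
  calc ∑ i, ∑ j, F i j = ∑ i, ∑ j, ((if i = j then F i j else 0) +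
        (if i < j then F i j else 0) + (if j < i then F i j else 0)) :=
        Finset.sum_congr rfl fun i _ => Finset.sum_congr rfl fun j _ => h1 i j
    _ = _ := by
      simp only [Finset.sum_add_distrib, h2, Finset.sum_ite_eq, Finset.mem_univ, if_true]
      ring

lemma sum_swapInd {n : ℕ} {x w : Equiv.Perm (Fin n)} (h : bruhatLE x w) :
    ∑ i, ∑ j, swapInd x w i j = n + 2 * pairCount x w := by
  rw [sum_eq_diag_add_two_mul _ (swapInd_comm x w)]
  congr 1
  · simp [swapInd_self h]
  · unfold pairCount swapInd
    rw [Finset.card_filter, Fintype.sum_prod_type]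
    push_cast
    simp only [ite_and]

lemma sum_swapInd_mul_swap_le {n : ℕ} {x w : Equiv.Perm (Fin n)} {a b : Fin n}
    (hab : a < b) (hv : x a < x b) (hx : bruhatLE x w)
    (hxt : bruhatLE (x * Equiv.swap a b) w) :
    ∑ i, ∑ j, swapInd (x * Equiv.swap a b) w i j ≤ ∑ i, ∑ j, swapInd x w i j := by
  rw [← sub_nonneg, ← Finset.sum_sub_distrib]
  simp only [← Finset.sum_sub_distrib]
  set D : Fin n → Fin n → ℤ :=
    fun i j => swapInd x w i j - swapInd (x * Equiv.swap a b) w i j with hD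
  change 0 ≤ ∑ i, ∑ j, D i j
  have hcomm : ∀ i j, D i j = D j i := fun i j => by
    simp only [hD, swapInd_comm _ _ i j]
  have hself : ∀ i, D i i = 0 := fun i => by simp [hD, swapInd_self hx, swapInd_self hxt]
  have hDab : D a b = 0 := by simp [hD, swapInd, mul_assoc, hx, hxt]
  have hdisj : ∀ i j, i ≠ a → i ≠ b → j ≠ a → j ≠ b → 0 ≤ D i j := fun i j h1 h2 h3 h4 =>
    sub_nonneg.2 (swapInd_mul_swap_of_disjoint hab hv h1 h2 h3 h4)
  have hthree : ∀ c, c ≠ a → c ≠ b → 0 ≤ D a c + D b c := fun c h1 h2 => by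
    have := swapInd_add_mul_swap_le hab hv h1 h2 hx hxt
    simp only [hD]
    linarith
  set t := Equiv.swap a b with ht
  have hti : t a = b := Equiv.swap_apply_left a b
  have htj : t b = a := Equiv.swap_apply_right a b
  have hto : ∀ k, k ≠ a → k ≠ b → t k = k := fun k => Equiv.swap_apply_of_ne_of_ne
  have hrow : ∀ i, ∑ j, D i (t j) = ∑ j, D i j := fun i => Equiv.sum_comp t (D i)
  have hcol : ∑ i, ∑ j, D (t i) j = ∑ i, ∑ j, D i j :=
    Equiv.sum_comp t fun i => ∑ j, D i j
  have havg : 0 ≤ ∑ i, ∑ j, (D i j + D (t i) j + D i (t j) + D (t i) (t j)) := by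
    refine Finset.sum_nonneg fun i _ => Finset.sum_nonneg fun j _ => ?_
    have := hdisj i j
    have := hthree i
    have := hthree j
    by_cases hia : i = a <;> by_cases hib : i = b <;> by_cases hja : j = a <;>
      by_cases hjb : j = b <;> grind
  simp only [Finset.sum_add_distrib, hrow, hcol] at havg
  linarith

lemma pairCount_mul_swap_le {n : ℕ} {x w : Equiv.Perm (Fin n)} {a b : Fin n}
    (hab : a < b) (hv : x a < x b) (hx : bruhatLE x w)
    (hxt : bruhatLE (x * Equiv.swap a b) w) :
    pairCount (x * Equiv.swap a b) w ≤ pairCount x w := by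
  have h := sum_swapInd_mul_swap_le hab hv hx hxt
  rw [sum_swapInd hx, sum_swapInd hxt] at h
  omega

lemma upCount_add_invLen {n : ℕ} {x w : Equiv.Perm (Fin n)} (h : bruhatLE x w) :
    pairCount x w = upCount x w + invLen x := by
  unfold pairCount upCount invLen
  rw [← Finset.card_filter_add_card_filter_not (fun r : Fin n × Fin n => x r.1 < x r.2),
    Finset.filter_filter, Finset.filter_filter]
  congr 2
  ext ⟨i, j⟩
  simp only [Finset.mem_filter, Finset.mem_univ, true_and, not_lt]
  constructor
  · rintro ⟨⟨hij, -⟩, hle⟩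
    exact ⟨hij, lt_of_le_of_ne hle fun he => hij.ne' (x.injective he)⟩
  · rintro ⟨hij, hlt⟩
    exact ⟨⟨hij, (mul_swap_bruhatLE x hij hlt).trans h⟩, hlt.le⟩

lemma upCount_le_ncard {n : ℕ} (x w : Equiv.Perm (Fin n)) : upCount x w ≤ (R x w).ncard := by
  unfold upCount
  rw [← Set.ncard_coe_finset]
  refine Set.ncard_le_ncard_of_injOn (fun r => Equiv.swap r.1 r.2) ?_ ?_ (Set.toFinite _)
  · rintro ⟨i, j⟩ hr
    simp only [Finset.coe_filter, Finset.mem_univ, true_and, Set.mem_ofPred_eq] at hr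
    exact ⟨⟨i, j, hr.1.1.ne, rfl⟩, invLen_lt_mul_swap x hr.1.1 hr.2, hr.1.2⟩
  · rintro ⟨i, j⟩ hr ⟨i', j'⟩ hr' he
    simp only [Finset.coe_filter, Finset.mem_univ, true_and, Set.mem_ofPred_eq] at hr hr' he
    have h1 := Equiv.swap_apply_left i j
    have h2 := Equiv.swap_apply_right i j
    rw [he, Equiv.swap_apply_def] at h1 h2
    split_ifs at h1 h2 <;> grind

lemma invLen_le_pairCount {n : ℕ} {x w : Equiv.Perm (Fin n)} (h : bruhatLE x w) :
    invLen w ≤ pairCount x w := by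
  induction hk : n * n - invLen x using Nat.strong_induction_on generalizing x with
  | _ k ih =>
  by_cases hne : x = w
  · subst hne
    rw [upCount_add_invLen h]
    exact Nat.le_add_left _ _
  · obtain ⟨i, j, hij, hv, hle⟩ := exists_swap_le h hne
    have hlt := invLen_lt_mul_swap x hij hv
    have hbd := invLen_le (x * Equiv.swap i j)
    exact (ih _ (by omega) hle rfl).trans (pairCount_mul_swap_le hij hv h hle)

/-- Deodhar's inequality in type A: if `y ≤ w` then `#R(y,w) ≥ l(w) − l(y)`. -/
theorem deodhar_inequality {n : ℕ} (y w : Equiv.Perm (Fin n)) (hyw : bruhatLE y w) :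
    (invLen w : ℤ) - (invLen y : ℤ) ≤ ((R y w).ncard : ℤ) := by
  have hN := upCount_add_invLen hyw
  have hR := upCount_le_ncard y w
  have h := invLen_le_pairCount hyw
  omega

end BSW
end

section
/- Let u, w ∈ S_n and 1 ≤ i < j < k ≤ n with u(i) < u(j) < u(k). Define x, y, z ∈ S_n to agree with u at every position outside {i,j,k}, with x(i) = u(k), x(j) = u(i), x(k) = u(j) (pattern 312 at these positions); y(i) = u(j), y(j) = u(k), y(k) = u(i) (pattern 231); and z(i) = u(k), z(j) = u(j), z(k) = u(i) (pattern 321). If x ≤ w and y ≤ w, then z ≤ w. -/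
open scoped Classical

namespace BSW

/-- Swapping the values at two positions that are both within the first `p`, or both
beyond them, does not change the rank function at `p`. -/
theorem rank_mul_swap {n : ℕ} (x : Equiv.Perm (Fin n)) {a b : Fin n} {p : ℤ} (q : ℤ)
    (h : ((a : ℕ) : ℤ) + 1 ≤ p ↔ ((b : ℕ) : ℤ) + 1 ≤ p) :
    rank (x * Equiv.swap a b) p q = rank x p q := by
  unfold rank
  refine Finset.card_equiv (Equiv.swap a b) fun d => ?_
  rw [Finset.mem_filter_univ, Finset.mem_filter_univ, Equiv.Perm.mul_apply]
  refine and_congr_left fun _ => ?_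
  rcases eq_or_ne d a with rfl | hda
  · rwa [Equiv.swap_apply_left]
  rcases eq_or_ne d b with rfl | hdb
  · rw [Equiv.swap_apply_right]
    exact h.symm
  · rw [Equiv.swap_apply_of_ne_of_ne hda hdb]

/-- If `u(i) < u(j) < u(k)` for `i < j < k`, the permutations `x, y, z` agree with
`u` outside `{i,j,k}` and place the three values `u(i),u(j),u(k)` there in the
patterns `312`, `231`, `321` respectively, and `x ≤ w` and `y ≤ w`, then `z ≤ w`. -/
theorem le_of_312_and_231 {n : ℕ} (u w x y z : Equiv.Perm (Fin n)) (i j k : Fin n)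
    (hij : i < j) (hjk : j < k) (hui : u i < u j) (huj : u j < u k)
    (hx : (∀ d : Fin n, d ≠ i → d ≠ j → d ≠ k → x d = u d) ∧
      x i = u k ∧ x j = u i ∧ x k = u j)
    (hy : (∀ d : Fin n, d ≠ i → d ≠ j → d ≠ k → y d = u d) ∧
      y i = u j ∧ y j = u k ∧ y k = u i)
    (hz : (∀ d : Fin n, d ≠ i → d ≠ j → d ≠ k → z d = u d) ∧
      z i = u k ∧ z j = u j ∧ z k = u i)
    (hxw : bruhatLE x w) (hyw : bruhatLE y w) :
    bruhatLE z w := by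
  obtain ⟨hx, hxi, hxj, hxk⟩ := hx
  obtain ⟨hy, hyi, hyj, hyk⟩ := hy
  obtain ⟨hz, hzi, hzj, hzk⟩ := hz
  have hzx : z = x * Equiv.swap j k := by
    ext1 d
    rw [Equiv.Perm.mul_apply]
    rcases eq_or_ne d j with rfl | hdj
    · rw [Equiv.swap_apply_left, hzj, hxk]
    rcases eq_or_ne d k with rfl | hdk
    · rw [Equiv.swap_apply_right, hzk, hxj]
    rw [Equiv.swap_apply_of_ne_of_ne hdj hdk]
    rcases eq_or_ne d i with rfl | hdi
    · rw [hzi, hxi]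
    · rw [hz d hdi hdj hdk, hx d hdi hdj hdk]
  have hzy : z = y * Equiv.swap i j := by
    ext1 d
    rw [Equiv.Perm.mul_apply]
    rcases eq_or_ne d i with rfl | hdi
    · rw [Equiv.swap_apply_left, hzi, hyj]
    rcases eq_or_ne d j with rfl | hdj
    · rw [Equiv.swap_apply_right, hzj, hyi]
    rw [Equiv.swap_apply_of_ne_of_ne hdi hdj]
    rcases eq_or_ne d k with rfl | hdk
    · rw [hzk, hyk]
    · rw [hz d hdi hdj hdk, hy d hdi hdj hdk]
  intro p q
  by_cases hp : ((j : ℕ) : ℤ) + 1 ≤ p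
  · have hr : rank z p q = rank y p q := hzy ▸ rank_mul_swap y q (by omega)
    simpa only [dxw, hr] using hyw p q
  · have hr : rank z p q = rank x p q := hzx ▸ rank_mul_swap x q (by omega)
    simpa only [dxw, hr] using hxw p q

end BSW
end
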